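/- Let s∈(0,1) and let K satisfy (K1) and (K2). Let x̄ ≥ 1, let a, A > 0 be real parameters, let B, D ≤ 1 − a·x̄^{−A}, and define φ_{x̄}: ℝ → ℝ by φ_{x̄}(x) := B for x ≤ 0, φ_{x̄}(x) := D for 0 < x < x̄, and φ_{x̄}(x) := 1 − a·x^{−A} for x ≥ x̄. Then there exists a constant C > 0, depending only on s, λ and Λ, such that for every x ≥ 2x̄, x^{2s} · L_K φ_{x̄}(x) ≤ −λ(1−B)/(2s) + a·C·x^{−A}. -/

import Mathlib

open MeasureTheory Filter Set Topology

/-- The principal value operator `L_K u (x)` (junk value if the limit does not exist). -/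
noncomputable def LK (K u : ℝ → ℝ) (x : ℝ) : ℝ :=
  limUnder (nhdsWithin (0:ℝ) (Set.Ioi 0))
    (fun ε : ℝ => ∫ y in {y : ℝ | ε < |y - x|}, (u y - u x) * K (x - y))

/-- The graph of `y ↦ y ^ (-A)` lies above its tangent lines. -/
theorem rpow_neg_tangent_le {A x y : ℝ} (hA : 0 ≤ A) (hx : 0 < x) (hy : 0 < y) :
    x ^ (-A) - A * x ^ (-A - 1) * (y - x) ≤ y ^ (-A) := by
  have ht : 0 < y / x := div_pos hy hx
  have h1 : 1 - A * (y / x - 1) ≤ (y / x) ^ (-A) := by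
    rw [Real.rpow_def_of_pos ht]
    have h2 := Real.add_one_le_exp (Real.log (y / x) * (-A))
    have h3 := mul_le_mul_of_nonneg_left (Real.log_le_sub_one_of_pos ht) hA
    linarith
  rw [Real.div_rpow hy.le hx.le, le_div_iff₀ (Real.rpow_pos_of_pos hx _)] at h1
  rw [Real.rpow_sub_one hx.ne']
  refine le_trans (le_of_eq ?_) h1
  field_simp

/-- The deviation of `y ↦ y ^ (-A)` from its tangent line at `x` is quadratic on `[x / 2, ∞)`. -/
theorem rpow_neg_sub_tangent_le {A x y : ℝ} (hA : 0 ≤ A) (hx : 0 < x) (hy : x / 2 ≤ y) :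
    y ^ (-A) - (x ^ (-A) - A * x ^ (-A - 1) * (y - x)) ≤
      A * (A + 1) * (x / 2) ^ (-A - 2) * (y - x) ^ 2 := by
  have hx2 : 0 < x / 2 := by linarith
  have hy0 : 0 < y := by linarith
  have h1 := rpow_neg_tangent_le hA hy0 hx
  have e1 : -(A + 1) = -A - 1 := by ring
  have e2 : -A - 1 - 1 = -A - 2 := by ring
  have hA1 : 0 ≤ A + 1 := by linarith
  have h2 := rpow_neg_tangent_le hA1 hy0 hx
  have h3 := rpow_neg_tangent_le hA1 hx hy0
  rw [e1, e2] at h2 h3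
  have h4 : y ^ (-A - 2) ≤ (x / 2) ^ (-A - 2) :=
    Real.rpow_le_rpow_of_nonpos hx2 hy (by linarith)
  have h5 : x ^ (-A - 2) ≤ (x / 2) ^ (-A - 2) :=
    Real.rpow_le_rpow_of_nonpos hx2 (by linarith) (by linarith)
  have key : (x ^ (-A - 1) - y ^ (-A - 1)) * (y - x) ≤
      (A + 1) * (x / 2) ^ (-A - 2) * (y - x) ^ 2 := by
    rcases le_total x y with h | h
    · have h6 : x ^ (-A - 1) - y ^ (-A - 1) ≤ (A + 1) * (x / 2) ^ (-A - 2) * (y - x) := by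
        have := mul_le_mul_of_nonneg_right (mul_le_mul_of_nonneg_left h5 hA1) (sub_nonneg.2 h)
        linarith
      have := mul_le_mul_of_nonneg_right h6 (sub_nonneg.2 h)
      linarith
    · have h6 : y ^ (-A - 1) - x ^ (-A - 1) ≤ (A + 1) * (x / 2) ^ (-A - 2) * (x - y) := by
        have := mul_le_mul_of_nonneg_right (mul_le_mul_of_nonneg_left h4 hA1) (sub_nonneg.2 h)
        linarith
      have := mul_le_mul_of_nonneg_right h6 (sub_nonneg.2 h)
      linarith
  have := mul_le_mul_of_nonneg_left key hA
  linarith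

theorem MeasureTheory.IntegrableOn.integrable_comp_abs {w : ℝ → ℝ} (hw : IntegrableOn w (Ioi 0)) :
    Integrable (fun t : ℝ => w |t|) := by
  have h := (integrable_indicator_iff measurableSet_Ioi).2 hw
  refine (h.add h.comp_neg).congr ?_
  filter_upwards [compl_mem_ae_iff.2 (measure_singleton (0 : ℝ))] with t ht
  rcases lt_or_gt_of_ne (show t ≠ 0 from ht) with h0 | h0
  · have h1 : ¬ 0 < t := by linarith
    simp [h0, h1, abs_of_neg h0]
  · have h1 : ¬ t < 0 := by linarith
    simp [h0, h1, abs_of_pos h0]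

theorem integrable_ite_lt_abs_rpow {p r : ℝ} (hp : p < -1) (hr : 0 < r) :
    Integrable (fun t : ℝ => if r < |t| then |t| ^ p else 0) := by
  refine IntegrableOn.integrable_comp_abs (w := (Ioi r).indicator fun t => t ^ p) ?_
  exact ((integrable_indicator_iff measurableSet_Ioi).2
    (integrableOn_Ioi_rpow_of_lt hp hr)).integrableOn

theorem integrable_ite_abs_le_rpow {p r : ℝ} (hp : -1 < p) (hr : 0 < r) :
    Integrable (fun t : ℝ => if |t| ≤ r then |t| ^ p else 0) := by
  refine IntegrableOn.integrable_comp_abs (w := (Iic r).indicator fun t => t ^ p) ?_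
  rw [IntegrableOn, integrable_indicator_iff measurableSet_Iic, IntegrableOn,
    Measure.restrict_restrict measurableSet_Iic, inter_comm, Ioi_inter_Iic]
  exact (intervalIntegrable_iff_integrableOn_Ioc_of_le hr.le).1
    (intervalIntegral.intervalIntegrable_rpow' hp)

/-- The principal value at `0` of `v * K`, for a symmetric kernel `K` of order `2s` and a bounded
function `v` which agrees to second order with `t ↦ -c * t` at the origin. -/
theorem tendsto_pv_integral {s Lam c r M N : ℝ} {K v : ℝ → ℝ} (hs : s ∈ Ioo (0:ℝ) 1)
    (hr : 0 < r) (hM : 0 ≤ M) (hN : 0 ≤ N) (hK : Measurable K) (hsym : ∀ᵐ x : ℝ, K (-x) = K x)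
    (hbd : ∀ᵐ x : ℝ, 0 ≤ K x ∧ K x ≤ Lam * |x| ^ (-(1 + 2*s))) (hv : Measurable v)
    (hfar : ∀ t, r < |t| → |v t| ≤ M) (hnear : ∀ t, |t| ≤ r → |v t + c * t| ≤ N * t ^ 2) :
    Integrable (fun t => (v t + if |t| ≤ r then c * t else 0) * K t) ∧
    Tendsto (fun ε : ℝ => ∫ t in {t : ℝ | ε < |t|}, v t * K t) (𝓝[>] 0)
      (𝓝 (∫ t, (v t + if |t| ≤ r then c * t else 0) * K t)) := by
  obtain ⟨hs0, hs1⟩ := hs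
  have hmset : ∀ ε : ℝ, MeasurableSet {t : ℝ | ε < |t|} := fun ε =>
    measurableSet_lt measurable_const measurable_id.abs
  have hmset' : MeasurableSet {t : ℝ | |t| ≤ r} :=
    measurableSet_le measurable_id.abs measurable_const
  set G : ℝ → ℝ := fun t => (v t + if |t| ≤ r then c * t else 0) * K t with hG
  have hmG : Measurable G :=
    (hv.add (Measurable.ite hmset' (measurable_id.const_mul c) measurable_const)).mul hK
  have hI : Integrable G := by
    refine (((integrable_ite_lt_abs_rpow (p := -(1 + 2*s)) (by linarith) hr).const_mul
      (M * Lam)).add ((integrable_ite_abs_le_rpow (p := 2 - (1 + 2*s)) (by linarith) hr).const_mul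
      (N * Lam))).mono' hmG.aestronglyMeasurable ?_
    filter_upwards [hbd, compl_mem_ae_iff.2 (measure_singleton (0 : ℝ))] with t ht ht0
    have ht0 : 0 < |t| := abs_pos.2 ht0
    simp only [hG, Pi.add_apply, norm_mul, Real.norm_eq_abs, abs_of_nonneg ht.1]
    by_cases h : |t| ≤ r
    · simp only [h, not_lt.2 h, if_true, if_false, mul_zero, zero_add]
      calc |v t + c * t| * K t ≤ (N * t ^ 2) * (Lam * |t| ^ (-(1 + 2*s))) :=
            mul_le_mul (hnear t h) ht.2 ht.1 (by positivity)
        _ = N * Lam * |t| ^ (2 - (1 + 2*s)) := by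
            rw [sub_eq_add_neg, Real.rpow_add ht0, Real.rpow_two, sq_abs]; ring
    · simp only [h, not_le.1 h, if_true, if_false, mul_zero, add_zero]
      calc |v t| * K t ≤ M * (Lam * |t| ^ (-(1 + 2*s))) :=
            mul_le_mul (hfar t (not_le.1 h)) ht.2 ht.1 hM
        _ = M * Lam * |t| ^ (-(1 + 2*s)) := by ring
  refine ⟨hI, ?_⟩
  have hlim : Tendsto (fun ε : ℝ => ∫ t in {t : ℝ | ε < |t|}, G t) (𝓝[>] 0) (𝓝 (∫ t, G t)) := by
    simp_rw [← integral_indicator (hmset _)]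
    refine tendsto_integral_filter_of_dominated_convergence (fun t => ‖G t‖)
      (Eventually.of_forall fun ε => (hmG.indicator (hmset ε)).aestronglyMeasurable)
      (Eventually.of_forall fun ε => Eventually.of_forall fun t => norm_indicator_le_norm_self _ _)
      hI.norm ?_
    filter_upwards [compl_mem_ae_iff.2 (measure_singleton (0 : ℝ))] with t ht0
    have ht0 : 0 < |t| := abs_pos.2 ht0
    refine tendsto_const_nhds.congr' ?_
    filter_upwards [mem_nhdsWithin_of_mem_nhds (Iio_mem_nhds ht0)] with ε hε
    exact (indicator_of_mem (show t ∈ {t : ℝ | ε < |t|} from hε) G).symm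
  refine hlim.congr' ?_
  filter_upwards [self_mem_nhdsWithin] with ε hε
  have hε : 0 < ε := hε
  set q : ℝ → ℝ := {t : ℝ | ε < |t|}.indicator fun t => (if |t| ≤ r then c * t else 0) * K t with hq
  have hmq : Measurable q := (((Measurable.ite hmset' (measurable_id.const_mul c)
    measurable_const)).mul hK).indicator (hmset ε)
  have hqI : Integrable q := by
    refine ((integrable_ite_lt_abs_rpow (p := -(1 + 2*s)) (by linarith) hε).const_mul
      (|c| * r * Lam)).mono' hmq.aestronglyMeasurable ?_
    filter_upwards [hbd] with t ht
    simp only [hq, indicator, mem_ofPred_eq]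
    split_ifs with h1 h2
    · rw [norm_mul, norm_mul, Real.norm_eq_abs, Real.norm_eq_abs, Real.norm_eq_abs,
        abs_of_nonneg ht.1]
      calc |c| * |t| * K t ≤ |c| * r * (Lam * |t| ^ (-(1 + 2*s))) :=
            mul_le_mul (mul_le_mul_of_nonneg_left h2 (abs_nonneg c)) ht.2 ht.1 (by positivity)
        _ = _ := by ring
    · simp only [zero_mul, norm_zero]
      have := mul_nonneg (mul_nonneg (abs_nonneg c) hr.le) (ht.1.trans ht.2)
      linarith
    · simp
  have hq0 : ∫ t, q t = 0 := by
    have h1 : ∫ t, q (-t) = ∫ t, q t := integral_neg_eq_self q volume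
    have h2 : ∫ t, q (-t) = ∫ t, -q t := by
      refine integral_congr_ae ?_
      filter_upwards [hsym] with t ht
      simp only [hq, indicator, mem_ofPred_eq, abs_neg, ht]
      split_ifs <;> ring
    rw [integral_neg] at h2
    linarith
  rw [← integral_indicator (hmset ε), ← integral_indicator (hmset ε)]
  have h3 : ({t : ℝ | ε < |t|}.indicator fun t => v t * K t) =
      fun t => {t : ℝ | ε < |t|}.indicator G t - q t := by
    funext t
    simp only [hq, hG, indicator]
    split_ifs <;> ring
  rw [h3, integral_sub (hI.indicator (hmset ε)) hqI, hq0, sub_zero]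

theorem integral_indicator_Ioi_rpow {s r : ℝ} (hs : 0 < s) (hr : 0 < r) :
    ∫ t, (Ioi r).indicator (fun t : ℝ => t ^ (-(1 + 2*s))) t = r ^ (-(2*s)) / (2*s) := by
  rw [integral_indicator measurableSet_Ioi, integral_Ioi_rpow_of_lt (by linarith) hr,
    show -(1 + 2*s) + 1 = -(2*s) by ring, neg_div_neg_eq]

theorem LK_eq_of_tendsto {K u : ℝ → ℝ} {x l : ℝ}
    (h : Tendsto (fun ε : ℝ => ∫ t in {t : ℝ | ε < |t|}, (u (x - t) - u x) * K t) (𝓝[>] 0) (𝓝 l)) :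
    LK K u x = l := by
  refine Tendsto.limUnder_eq (h.congr fun ε => ?_)
  have h1 : MeasurableSet {t : ℝ | ε < |t|} := measurableSet_lt measurable_const measurable_id.abs
  have h2 : MeasurableSet {y : ℝ | ε < |y - x|} :=
    measurableSet_lt measurable_const (measurable_id.sub_const x).abs
  rw [← integral_indicator h1, ← integral_indicator h2,
    ← integral_sub_left_eq_self _ volume x]
  congr 1
  funext t
  simp only [indicator, mem_ofPred_eq, sub_sub_cancel, abs_sub_comm t x]

theorem barrier_estimate (s lam Lam : ℝ)
    (hs : s ∈ Set.Ioo (0:ℝ) 1) (hlam : 0 < lam) (hlL : lam ≤ Lam) :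
    -- the constant C depends only on s, λ and Λ
    ∃ C > (0:ℝ),
      ∀ K : ℝ → ℝ, Measurable K → (∀ᵐ x : ℝ, K (-x) = K x) →
        (∀ᵐ x : ℝ, lam / |x| ^ (1 + 2*s) ≤ K x ∧ K x ≤ Lam / |x| ^ (1 + 2*s)) →
      ∀ xb a A B D : ℝ, 1 ≤ xb → 0 < a → 0 < A →
        B ≤ 1 - a * xb ^ (-A) → D ≤ 1 - a * xb ^ (-A) →
        ∀ x, 2 * xb ≤ x →
          x ^ (2*s) *
              LK K (fun y => if y ≤ 0 then B else if y < xb then D else 1 - a * y ^ (-A)) x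
            ≤ -(lam * (1 - B)) / (2*s) + a * C * x ^ (-A) := by
  have hs0 : 0 < s := hs.1
  have hLam : 0 < Lam := hlam.trans_le hlL
  refine ⟨Lam * (1 + 2 ^ (2*s)) / (2*s), by positivity, ?_⟩
  intro K hK hsym hbd xb a A B D hxb ha hA hB hD x hx
  have hx0 : 0 < x := by linarith
  have hxb0 : 0 < xb := by linarith
  have hbd' : ∀ᵐ t : ℝ, lam * |t| ^ (-(1 + 2*s)) ≤ K t ∧ K t ≤ Lam * |t| ^ (-(1 + 2*s)) := by
    filter_upwards [hbd] with t ht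
    rwa [Real.rpow_neg (abs_nonneg t), ← div_eq_mul_inv, ← div_eq_mul_inv]
  have hbd0 : ∀ᵐ t : ℝ, 0 ≤ K t ∧ K t ≤ Lam * |t| ^ (-(1 + 2*s)) := by
    filter_upwards [hbd'] with t ht
    exact ⟨le_trans (by positivity) ht.1, ht.2⟩
  set u : ℝ → ℝ := fun y => if y ≤ 0 then B else if y < xb then D else 1 - a * y ^ (-A) with hu
  have u_left : ∀ y, y ≤ 0 → u y = B := fun y hy => by simp [hu, hy]
  have u_mid : ∀ y, 0 < y → y < xb → u y = D := fun y h1 h2 => by simp [hu, not_le.2 h1, h2]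
  have u_right : ∀ y, xb ≤ y → u y = 1 - a * y ^ (-A) := fun y hy => by
    simp [hu, not_le.2 (hxb0.trans_le hy), not_lt.2 hy]
  have hux := u_right x (by linarith)
  have hmu : Measurable u :=
    Measurable.ite measurableSet_Iic measurable_const
      (Measurable.ite measurableSet_Iio measurable_const (by fun_prop))
  have hpow : ∀ y, xb ≤ y → 0 < y ^ (-A) ∧ y ^ (-A) ≤ 1 := fun y hy =>
    ⟨Real.rpow_pos_of_pos (by linarith) _,
      Real.rpow_le_one_of_one_le_of_nonpos (by linarith) (by linarith)⟩
  have hubd : ∀ y, |u y| ≤ |B| + |D| + 1 + a := by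
    intro y
    rcases le_or_gt y 0 with h | h
    · rw [u_left y h]; linarith [abs_nonneg D]
    rcases lt_or_ge y xb with h' | h'
    · rw [u_mid y h h']; linarith [abs_nonneg B]
    · rw [u_right y h', abs_le]
      have h1 := hpow y h'
      have h2 := mul_pos ha h1.1
      have h3 := mul_le_mul_of_nonneg_left h1.2 ha.le
      constructor <;> linarith [abs_nonneg B, abs_nonneg D]
  set c : ℝ := a * (A * x ^ (-A - 1)) with hc
  have hconc : ∀ t, |t| ≤ x / 2 → u (x - t) - u x + c * t ≤ 0 := by
    intro t ht
    have ht' := abs_le.1 ht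
    rw [u_right (x - t) (by linarith), hux]
    have h1 := mul_le_mul_of_nonneg_left
      (rpow_neg_tangent_le hA.le hx0 (show 0 < x - t by linarith)) ha.le
    rw [hc]
    linarith
  obtain ⟨hI, hlim⟩ := tendsto_pv_integral (c := c) (r := x / 2)
    (M := 2 * (|B| + |D| + 1 + a)) (N := a * (A * (A + 1) * (x / 2) ^ (-A - 2)))
    (v := fun t => u (x - t) - u x) hs (by linarith) (by positivity) (by positivity) hK hsym hbd0
    ((hmu.comp (measurable_const.sub measurable_id)).sub_const _)
    (fun t _ => by
      have h1 := abs_sub (u (x - t)) (u x)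
      linarith [hubd (x - t), hubd x])
    (fun t ht => by
      rw [abs_of_nonpos (hconc t ht)]
      have ht' := abs_le.1 ht
      rw [u_right (x - t) (by linarith), hux, hc]
      have h1 := mul_le_mul_of_nonneg_left
        (rpow_neg_sub_tangent_le hA.le hx0 (show x / 2 ≤ x - t by linarith)) ha.le
      have h2 : (x - t - x) ^ 2 = t ^ 2 := by ring
      rw [h2] at h1
      linarith)
  rw [LK_eq_of_tendsto hlim]
  have hint : ∀ r : ℝ, 0 < r →
      Integrable ((Ioi r).indicator fun t : ℝ => t ^ (-(1 + 2*s))) := fun r hr =>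
    (integrable_indicator_iff measurableSet_Ioi).2 (integrableOn_Ioi_rpow_of_lt (by linarith) hr)
  have hx2 : 0 < x / 2 := by linarith
  have hxA := hpow x (by linarith)
  have hB1 : B ≤ 1 := by
    have := mul_pos ha (hpow xb le_rfl).1
    linarith
  have hmain : ∫ t, (u (x - t) - u x + if |t| ≤ x / 2 then c * t else 0) * K t ≤
      ∫ t, (((B - 1) * lam + a * x ^ (-A) * Lam) *
          (Ioi x).indicator (fun t : ℝ => t ^ (-(1 + 2*s))) t +
        a * x ^ (-A) * Lam * (Ioi (x / 2)).indicator (fun t : ℝ => t ^ (-(1 + 2*s))) (-t)) := by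
    refine integral_mono_ae hI (((hint x hx0).const_mul _).add
      ((hint _ hx2).comp_neg.const_mul _)) ?_
    filter_upwards [hbd', hbd0, compl_mem_ae_iff.2 (measure_singleton x)] with t ht ht0 htx
    have htx : t ≠ x := htx
    simp only [indicator, mem_Ioi]
    rcases le_or_gt |t| (x / 2) with h | h
    · have h' := abs_le.1 h
      rw [if_pos h, if_neg (by linarith), if_neg (by linarith)]
      have := mul_nonpos_of_nonpos_of_nonneg (hconc t h) ht0.1
      linarith
    rw [if_neg (not_le.2 h), add_zero]
    rcases lt_or_ge t 0 with hneg | hpos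
    · rw [abs_of_neg hneg] at h ht
      rw [if_neg (by linarith), if_pos h, u_right (x - t) (by linarith), hux]
      have h1 := mul_pos ha (hpow (x - t) (by linarith)).1
      calc _ ≤ (a * x ^ (-A)) * K t := mul_le_mul_of_nonneg_right (by linarith) ht0.1
        _ ≤ (a * x ^ (-A)) * (Lam * (-t) ^ (-(1 + 2*s))) :=
            mul_le_mul_of_nonneg_left ht.2 (mul_pos ha hxA.1).le
        _ = _ := by ring
    rw [abs_of_nonneg hpos] at h ht
    rcases lt_or_gt_of_ne htx with hlt | hgt
    · rw [if_neg (by linarith), if_neg (by linarith)]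
      have hle : u (x - t) ≤ u x := by
        rw [hux]
        rcases lt_or_ge (x - t) xb with h' | h'
        · rw [u_mid _ (by linarith) h']
          have h1 : x ^ (-A) ≤ xb ^ (-A) :=
            Real.rpow_le_rpow_of_nonpos hxb0 (by linarith) (by linarith)
          have := mul_le_mul_of_nonneg_left h1 ha.le
          linarith
        · rw [u_right _ h']
          have h1 : x ^ (-A) ≤ (x - t) ^ (-A) :=
            Real.rpow_le_rpow_of_nonpos (by linarith) (by linarith) (by linarith)
          have := mul_le_mul_of_nonneg_left h1 ha.le
          linarith
      have := mul_nonpos_of_nonpos_of_nonneg (sub_nonpos.2 hle) ht0.1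
      linarith
    · rw [if_pos hgt, if_neg (by linarith), u_left (x - t) (by linarith), hux]
      have h1 := mul_le_mul_of_nonneg_left ht.1 (sub_nonneg.2 hB1)
      have h2 := mul_le_mul_of_nonneg_left ht.2 (mul_pos ha hxA.1).le
      linarith
  rw [integral_add ((hint x hx0).const_mul _) ((hint _ hx2).comp_neg.const_mul _),
    integral_const_mul, integral_const_mul, integral_neg_eq_self,
    integral_indicator_Ioi_rpow hs0 hx0, integral_indicator_Ioi_rpow hs0 hx2,
    Real.div_rpow hx0.le (by norm_num), Real.rpow_neg hx0.le (2*s),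
    Real.rpow_neg (zero_le_two (α := ℝ)) (2*s)] at hmain
  have hxs : 0 < x ^ (2*s) := Real.rpow_pos_of_pos hx0 _
  refine (mul_le_mul_of_nonneg_left hmain hxs.le).trans (le_of_eq ?_)
  field_simp
  ring
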